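/- Let G be a finite simple graph with maximum degree Δ(G) ≥ 9 that is both C4-free and P5-free, i.e., G contains no induced subgraph isomorphic to the cycle on 4 vertices and none isomorphic to the path on 5 vertices. Then χ(G) ≤ max{Δ(G) − 1, ω(G)}. -/

import Mathlib

open SimpleGraph

namespace BK

section

variable {V : Type*}

/-- Working form of C4-freeness. -/
def C4F (G : SimpleGraph V) : Prop :=
  ∀ a b c d, G.Adj a b → G.Adj b c → G.Adj c d → G.Adj d a → a ≠ c → b ≠ d →
    ¬ G.Adj a c → G.Adj b d

/-- Working form of P5-freeness. -/
def P5F (G : SimpleGraph V) : Prop :=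
  ∀ a b c d e, G.Adj a b → G.Adj b c → G.Adj c d → G.Adj d e →
    ¬ G.Adj a c → ¬ G.Adj a d → ¬ G.Adj a e → ¬ G.Adj b d → ¬ G.Adj b e → ¬ G.Adj c e → False

/-- Partial colorability of a vertex set. -/
def PC (G : SimpleGraph V) (k : ℕ) (S : Finset V) : Prop :=
  ∃ c : V → Fin k, ∀ u ∈ S, ∀ v ∈ S, G.Adj u v → c u ≠ c v

/-- Induced 5-cycle. -/
structure IsC5 (G : SimpleGraph V) (a b c d e : V) : Prop where
  ab : G.Adj a b
  bc : G.Adj b c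
  cd : G.Adj c d
  de : G.Adj d e
  ea : G.Adj e a
  ac : ¬ G.Adj a c
  bd : ¬ G.Adj b d
  ce : ¬ G.Adj c e
  da : ¬ G.Adj d a
  eb : ¬ G.Adj e b

/-- The class of vertices playing the role of the second argument. -/
def Cl (G : SimpleGraph V) (e b c d x : V) : Prop :=
  G.Adj x e ∧ G.Adj x b ∧ ¬ G.Adj x c ∧ ¬ G.Adj x d

/-- Vertices complete to the cycle. -/
def Full (G : SimpleGraph V) (a b c d e x : V) : Prop :=
  G.Adj x a ∧ G.Adj x b ∧ G.Adj x c ∧ G.Adj x d ∧ G.Adj x e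

/-- Vertices anticomplete to the cycle. -/
def Non (G : SimpleGraph V) (a b c d e x : V) : Prop :=
  ¬ G.Adj x a ∧ ¬ G.Adj x b ∧ ¬ G.Adj x c ∧ ¬ G.Adj x d ∧ ¬ G.Adj x e

variable {G : SimpleGraph V} {a b c d e : V}

lemma IsC5.rot (h : IsC5 G a b c d e) : IsC5 G b c d e a :=
  ⟨h.bc, h.cd, h.de, h.ea, h.ab, h.bd, h.ce, h.da, h.eb, h.ac⟩

lemma IsC5.mem (h : IsC5 G a b c d e) : Cl G e b c d a :=
  ⟨h.ea.symm, h.ab, h.ac, fun t => h.da t.symm⟩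

lemma IsC5.ne (h : IsC5 G a b c d e) : e ≠ b := by
  rintro rfl; exact h.bd h.de.symm

lemma cl_clique (h4 : C4F G) (h : IsC5 G a b c d e) {x y : V} (hx : Cl G e b c d x)
    (hy : Cl G e b c d y) (hxy : x ≠ y) : G.Adj x y :=
  h4 e x b y hx.1.symm hx.2.1 hy.2.1.symm hy.1 h.ne hxy h.eb

lemma cl_next (h5 : P5F G) (h : IsC5 G a b c d e) {x y : V} (hx : Cl G e b c d x)
    (hy : Cl G a c d e y) : G.Adj x y := by
  by_contra hxy
  obtain ⟨x1, x2, x3, x4⟩ := hx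
  obtain ⟨y1, y2, y3, y4⟩ := hy
  exact h5 x e d c y x1 h.de.symm h.cd.symm y2.symm x4 x3 hxy
    (fun t => h.ce t.symm) (fun t => y4 t.symm) (fun t => y3 t.symm)

lemma cl_far (h4 : C4F G) (h : IsC5 G a b c d e) {x y : V} (hx : Cl G e b c d x)
    (hy : Cl G b d e a y) : ¬ G.Adj x y := by
  intro hxy
  obtain ⟨x1, x2, x3, x4⟩ := hx
  obtain ⟨y1, y2, y3, y4⟩ := hy
  have := h4 x y d e hxy y2 h.de x1.symm (by rintro rfl; exact h.bd x2.symm)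
    (by rintro rfl; exact h.eb y1) x4
  exact y3 this

lemma full_cl (h4 : C4F G) (h : IsC5 G a b c d e) {x y : V} (hx : Full G a b c d e x)
    (hy : Cl G e b c d y) : G.Adj x y :=
  h4 e x b y hx.2.2.2.2.symm hx.2.1 hy.2.1.symm hy.1 h.ne
    (by rintro rfl; exact hy.2.2.1 hx.2.2.1) h.eb

lemma full_clique (h4 : C4F G) (h : IsC5 G a b c d e) {x y : V} (hx : Full G a b c d e x)
    (hy : Full G a b c d e y) (hxy : x ≠ y) : G.Adj x y :=
  h4 e x b y hx.2.2.2.2.symm hx.2.1 hy.2.1.symm hy.2.2.2.2 h.ne hxy h.eb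

lemma non_cl (h5 : P5F G) (h : IsC5 G a b c d e) {x y : V} (hx : Non G a b c d e x)
    (hy : Cl G e b c d y) : ¬ G.Adj x y := by
  intro hxy
  obtain ⟨x1, x2, x3, x4, x5⟩ := hx
  obtain ⟨y1, y2, y3, y4⟩ := hy
  exact h5 x y b c d hxy y2 h.bc h.cd x2 x3 x4 y3 y4 h.bd

lemma Full.rot {x : V} (h : Full G a b c d e x) : Full G b c d e a x :=
  ⟨h.2.1, h.2.2.1, h.2.2.2.1, h.2.2.2.2, h.1⟩

lemma Non.rot {x : V} (h : Non G a b c d e x) : Non G b c d e a x :=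
  ⟨h.2.1, h.2.2.1, h.2.2.2.1, h.2.2.2.2, h.1⟩

lemma pat1 (h5 : P5F G) (h : IsC5 G a b c d e) {x : V} (hx : G.Adj x a) :
    G.Adj x b ∨ G.Adj x c ∨ G.Adj x d := by
  by_contra hc
  push Not at hc
  exact h5 x a b c d hx h.ab h.bc h.cd hc.1 hc.2.1 hc.2.2 h.ac (fun t => h.da t.symm) h.bd

lemma pat2 (h4 : C4F G) (h : IsC5 G a b c d e) {x : V} (hx : G.Adj x e) (hy : G.Adj x b) :
    Cl G e b c d x ∨ G.Adj x a := by
  by_cases hxa : x = a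
  · subst hxa; exact Or.inl h.mem
  · right
    exact h4 e x b a hx.symm hy h.ab.symm h.ea.symm h.ne hxa h.eb

lemma classify (h4 : C4F G) (h5 : P5F G) (h : IsC5 G a b c d e) (x : V) :
    Cl G e b c d x ∨ Cl G a c d e x ∨ Cl G b d e a x ∨ Cl G c e a b x ∨ Cl G d a b c x ∨
    Full G a b c d e x ∨ Non G a b c d e x := by
  have p1 := @pat1 _ _ _ _ _ _ _ h5 h x
  have p2 := @pat1 _ _ _ _ _ _ _ h5 h.rot x
  have p3 := @pat1 _ _ _ _ _ _ _ h5 h.rot.rot x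
  have p4 := @pat1 _ _ _ _ _ _ _ h5 h.rot.rot.rot x
  have p5 := @pat1 _ _ _ _ _ _ _ h5 h.rot.rot.rot.rot x
  have q1 := @pat2 _ _ _ _ _ _ _ h4 h x
  have q2 := @pat2 _ _ _ _ _ _ _ h4 h.rot x
  have q3 := @pat2 _ _ _ _ _ _ _ h4 h.rot.rot x
  have q4 := @pat2 _ _ _ _ _ _ _ h4 h.rot.rot.rot x
  have q5 := @pat2 _ _ _ _ _ _ _ h4 h.rot.rot.rot.rot x
  unfold Cl Full Non at *
  by_cases x1 : G.Adj x a <;> by_cases x2 : G.Adj x b <;> by_cases x3 : G.Adj x c <;>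
  by_cases x4 : G.Adj x d <;> by_cases x5 : G.Adj x e <;>
  simp_all

open Classical in
lemma glue {k : ℕ} {S₁ S₂ : Finset V} (h1 : PC G k S₁) (h2 : PC G k S₂)
    (hT : ∀ u ∈ S₁, u ∈ S₂ → ∀ v ∈ S₁, v ∈ S₂ → u ≠ v → G.Adj u v)
    (hn : ∀ u ∈ S₁, u ∉ S₂ → ∀ v ∈ S₂, v ∉ S₁ → ¬ G.Adj u v) : PC G k (S₁ ∪ S₂) := by
  obtain ⟨c1, h1⟩ := h1
  obtain ⟨c2, h2⟩ := h2
  let T : Set V := {u | u ∈ S₁ ∧ u ∈ S₂}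
  have i1 : Set.InjOn c1 T := by
    intro u hu v hv huv
    by_contra hne
    exact h1 u hu.1 v hv.1 (hT u hu.1 hu.2 v hv.1 hv.2 hne) huv
  have i2 : Set.InjOn c2 T := by
    intro u hu v hv huv
    by_contra hne
    exact h2 u hu.2 v hv.2 (hT u hu.1 hu.2 v hv.1 hv.2 hne) huv
  let e : {x // x ∈ c1 '' T} ≃ {x // x ∈ c2 '' T} :=
    (Equiv.Set.imageOfInjOn c1 T i1).symm.trans (Equiv.Set.imageOfInjOn c2 T i2)
  let σ : Equiv.Perm (Fin k) := e.extendSubtype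
  have hσ : ∀ t ∈ T, σ (c1 t) = c2 t := by
    intro t ht
    have : σ (c1 t) = e ⟨c1 t, ⟨t, ht, rfl⟩⟩ :=
      Equiv.extendSubtype_apply_of_mem e _ ⟨t, ht, rfl⟩
    rw [this]
    have h3 : (Equiv.Set.imageOfInjOn c1 T i1).symm ⟨c1 t, ⟨t, ht, rfl⟩⟩ = ⟨t, ht⟩ := by
      rw [Equiv.symm_apply_eq]; rfl
    simp only [e, Equiv.trans_apply, h3]
    rfl
  refine ⟨fun v => if v ∈ S₂ then c2 v else σ (c1 v), ?_⟩
  intro u hu v hv huv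
  rw [Finset.mem_union] at hu hv
  have key : ∀ u v, u ∈ S₂ → v ∈ S₁ → v ∉ S₂ → G.Adj u v → c2 u ≠ σ (c1 v) := by
    intro u v hu hv hv' huv
    by_cases hu1 : u ∈ S₁
    · rw [← hσ u ⟨hu1, hu⟩]
      exact fun t => h1 u hu1 v hv huv (σ.injective t)
    · exact absurd huv.symm (hn v hv hv' u hu hu1)
  by_cases hu2 : u ∈ S₂ <;> by_cases hv2 : v ∈ S₂ <;> simp only [hu2, hv2, if_true, if_false]
  · exact h2 u hu2 v hv2 huv
  · exact key u v hu2 (hv.resolve_right hv2) hv2 huv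
  · exact (key v u hv2 (hu.resolve_right hu2) hu2 huv.symm).symm
  · exact fun t => h1 u (hu.resolve_right hu2) v (hv.resolve_right hv2) huv (σ.injective t)

open Classical in
lemma color_classes {k n : ℕ} (S : Finset V) (hk : 0 < k) (F : Fin n → Finset V)
    (C : Fin n → Finset (Fin k))
    (hS : ∀ x ∈ S, ∃ i, x ∈ F i) (hc : ∀ i, (F i).card ≤ (C i).card)
    (hd : ∀ i j, i ≠ j → Disjoint (C i) (C j) ∨ ∀ u ∈ F i, ∀ v ∈ F j, ¬ G.Adj u v) :
    PC G k S := by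
  have hg : ∀ i, ∃ g : V → Fin k, (∀ x ∈ F i, g x ∈ C i) ∧ Set.InjOn g (F i) := by
    intro i
    have : Fintype.card (F i) ≤ Fintype.card (C i) := by simpa using hc i
    obtain ⟨φ⟩ := Function.Embedding.nonempty_of_card_le this
    refine ⟨fun x => if h : x ∈ F i then φ ⟨x, h⟩ else ⟨0, hk⟩, ?_, ?_⟩
    · intro x hx
      simp [hx]
    · intro x hx y hy hxy
      have hx' : x ∈ F i := hx
      have hy' : y ∈ F i := hy
      simp only [hx', hy', dif_pos] at hxy
      have := φ.injective (Subtype.ext hxy)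
      simpa using this
  choose g hg1 hg2 using hg
  have hf : ∀ x, ∃ i : Option (Fin n), x ∈ S → ∃ j, i = some j ∧ x ∈ F j := by
    intro x
    by_cases hx : x ∈ S
    · obtain ⟨i, hi⟩ := hS x hx
      exact ⟨some i, fun _ => ⟨i, rfl, hi⟩⟩
    · exact ⟨none, fun h => absurd h hx⟩
  choose f hf using hf
  refine ⟨fun x => match f x with | none => ⟨0, hk⟩ | some i => g i x, ?_⟩
  intro u hu v hv huv
  obtain ⟨i, hi, hui⟩ := hf u hu
  obtain ⟨j, hj, hvj⟩ := hf v hv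
  simp only [hi, hj]
  intro heq
  by_cases hij : i = j
  · subst hij
    exact huv.ne (hg2 i hui hvj heq)
  · rcases hd i j hij with h | h
    · exact Finset.disjoint_left.1 h (hg1 i u hui) (heq ▸ hg1 j v hvj)
    · exact h u hui v hvj huv

lemma pick2 {α : Type*} [DecidableEq α] (S T : Finset α) (s t : ℕ) (hs : s ≤ S.card)
    (ht : t ≤ T.card) (hst : s + t ≤ (S ∪ T).card) :
    ∃ S' T' : Finset α, S' ⊆ S ∧ T' ⊆ T ∧ S'.card = s ∧ T'.card = t ∧ Disjoint S' T' := by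
  by_cases h : s ≤ (S \ T).card
  · obtain ⟨S', h1, h2⟩ := Finset.exists_subset_card_eq h
    obtain ⟨T', h3, h4⟩ := Finset.exists_subset_card_eq ht
    refine ⟨S', T', h1.trans Finset.sdiff_subset, h3, h2, h4, ?_⟩
    exact Finset.disjoint_of_subset_left h1
      (Finset.disjoint_of_subset_right h3 Finset.sdiff_disjoint)
  · obtain ⟨S', h1, h2, h3⟩ := Finset.exists_subsuperset_card_eq
      (Finset.sdiff_subset (s := S) (t := T)) (by omega) hs
    have h4 : S ∪ T ⊆ S' ∪ (T \ S') := by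
      intro x hx
      have := @h1 x
      simp only [Finset.mem_union, Finset.mem_sdiff] at *
      tauto
    have h5 := Finset.card_le_card h4
    have h6 := Finset.card_union_le S' (T \ S')
    obtain ⟨T', h7, h8⟩ := Finset.exists_subset_card_eq (show t ≤ (T \ S').card by omega)
    refine ⟨S', T', h2, h7.trans Finset.sdiff_subset, h3, h8, ?_⟩
    exact Finset.disjoint_of_subset_right h7 Finset.disjoint_sdiff

lemma pick_colors (k a0 a1 a2 a3 a4 b : ℕ) (h01 : a0 + a1 + b ≤ k) (h12 : a1 + a2 + b ≤ k)
    (h23 : a2 + a3 + b ≤ k) (h34 : a3 + a4 + b ≤ k) (h40 : a4 + a0 + b ≤ k)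
    (hs : a0 + a1 + a2 + a3 + a4 + 2 * b ≤ 2 * k) :
    ∃ C0 C1 C2 C3 C4 B : Finset (Fin k), C0.card = a0 ∧ C1.card = a1 ∧ C2.card = a2 ∧
      C3.card = a3 ∧ C4.card = a4 ∧ B.card = b ∧
      Disjoint C0 C1 ∧ Disjoint C1 C2 ∧ Disjoint C2 C3 ∧ Disjoint C3 C4 ∧ Disjoint C4 C0 ∧
      Disjoint C0 B ∧ Disjoint C1 B ∧ Disjoint C2 B ∧ Disjoint C3 B ∧ Disjoint C4 B := by
  obtain ⟨B, -, hB⟩ := Finset.exists_subset_card_eq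
    (show b ≤ (Finset.univ : Finset (Fin k)).card by simp; omega)
  obtain ⟨C0, hC0, hC0c⟩ := Finset.exists_subset_card_eq
    (show a0 ≤ (Bᶜ).card by simp [Finset.card_compl, hB]; omega)
  have d0 : Disjoint C0 B := by
    rw [Finset.disjoint_left]; intro x hx; simpa using hC0 hx
  have hR : ((C0 ∪ B)ᶜ).card = k - (a0 + b) := by
    rw [Finset.card_compl, Finset.card_union_of_disjoint d0, hC0c, hB]; simp
  obtain ⟨C1, hC1, hC1c⟩ := Finset.exists_subset_card_eq
    (show a1 ≤ ((C0 ∪ B)ᶜ).card by omega)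
  have hR1 : ((C0 ∪ B)ᶜ \ C1).card = k - (a0 + b) - a1 := by
    rw [Finset.card_sdiff_of_subset hC1, hR, hC1c]
  have hC4 : ∃ C4 ⊆ (C0 ∪ B)ᶜ, C4.card = a4 ∧ a2 + a3 + b + (C1 ∩ C4).card ≤ k := by
    by_cases h : a4 ≤ ((C0 ∪ B)ᶜ \ C1).card
    · obtain ⟨C4, h1, h2⟩ := Finset.exists_subset_card_eq h
      refine ⟨C4, h1.trans Finset.sdiff_subset, h2, ?_⟩
      have : C1 ∩ C4 = ∅ := Finset.disjoint_iff_inter_eq_empty.1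
        (Finset.disjoint_of_subset_right h1 Finset.disjoint_sdiff)
      rw [this]; simpa using h23
    · obtain ⟨C4, h1, h2, h3⟩ := Finset.exists_subsuperset_card_eq
        (Finset.sdiff_subset (s := (C0 ∪ B)ᶜ) (t := C1)) (n := a4) (by omega) (by omega)
      refine ⟨C4, h2, h3, ?_⟩
      have h4 : (C0 ∪ B)ᶜ ⊆ C1 ∪ C4 := by
        intro x hx
        have := @h1 x
        simp only [Finset.mem_union, Finset.mem_sdiff] at *
        tauto
      have h5 := Finset.card_le_card h4
      have h6 := Finset.card_union_add_card_inter C1 C4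
      omega
  obtain ⟨C4, hC4, hC4c, hint⟩ := hC4
  have key : ∀ X ⊆ (C0 ∪ B)ᶜ, Disjoint X C0 ∧ Disjoint X B := by
    intro X hX
    simp only [Finset.disjoint_left]
    refine ⟨fun x hx h => ?_, fun x hx h => ?_⟩ <;>
    · have := hX hx
      simp [h] at this
  obtain ⟨d10, d1B⟩ := key C1 hC1
  obtain ⟨d40, d4B⟩ := key C4 hC4
  have e1 : ((C1 ∪ B)ᶜ).card = k - (a1 + b) := by
    rw [Finset.card_compl, Finset.card_union_of_disjoint d1B, hC1c, hB]; simp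
  have e4 : ((C4 ∪ B)ᶜ).card = k - (a4 + b) := by
    rw [Finset.card_compl, Finset.card_union_of_disjoint d4B, hC4c, hB]; simp
  have e5 : (C1 ∪ B)ᶜ ∪ (C4 ∪ B)ᶜ = ((C1 ∩ C4) ∪ B)ᶜ := by
    ext x; simp only [Finset.mem_union, Finset.mem_compl, Finset.mem_inter]; tauto
  have e6 := Finset.card_union_le (C1 ∩ C4) B
  have e7 : ((C1 ∪ B)ᶜ ∪ (C4 ∪ B)ᶜ).card = k - ((C1 ∩ C4) ∪ B).card := by
    rw [e5, Finset.card_compl]; simp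
  obtain ⟨C2, C3, f2, f3, g2, g3, d23⟩ := pick2 ((C1 ∪ B)ᶜ) ((C4 ∪ B)ᶜ) a2 a3
    (by omega) (by omega) (by omega)
  have key2 : ∀ X Y : Finset (Fin k), X ⊆ (Y ∪ B)ᶜ → Disjoint X Y ∧ Disjoint X B := by
    intro X Y hX
    simp only [Finset.disjoint_left]
    refine ⟨fun x hx h => ?_, fun x hx h => ?_⟩ <;>
    · have := hX hx
      simp [h] at this
  obtain ⟨d21, d2B⟩ := key2 _ _ f2
  obtain ⟨d34, d3B⟩ := key2 _ _ f3
  exact ⟨C0, C1, C2, C3, C4, B, hC0c, hC1c, g2, g3, hC4c, hB, d10.symm, d21.symm, d23, d34,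
    d40, d0, d1B, d2B, d3B, d4B⟩

open Classical in
lemma c5_deg (h4 : C4F G) {k : ℕ}
    (hdeg : ∀ v, ∀ T : Finset V, (∀ u ∈ T, G.Adj v u) → T.card ≤ k + 1)
    (h : IsC5 G a b c d e) (S : Finset V) :
    (S.filter (Cl G d a b c)).card + (S.filter (Cl G e b c d)).card +
      (S.filter (Cl G a c d e)).card + (S.filter (Full G a b c d e)).card ≤ k + 2 := by
  have hT := hdeg a ((S.filter (Cl G d a b c) ∪ S.filter (Cl G e b c d) ∪
    S.filter (Cl G a c d e) ∪ S.filter (Full G a b c d e)).erase a) (by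
      intro u hu
      simp only [Finset.mem_erase, Finset.mem_union, Finset.mem_filter] at hu
      obtain ⟨hne, ((hu | hu) | hu) | hu⟩ := hu
      · exact hu.2.2.1.symm
      · exact cl_clique h4 h h.mem hu.2 hne.symm
      · exact hu.2.1.symm
      · exact hu.2.1.symm)
  have h1 := Finset.pred_card_le_card_erase (a := a) (s := S.filter (Cl G d a b c) ∪
    S.filter (Cl G e b c d) ∪ S.filter (Cl G a c d e) ∪ S.filter (Full G a b c d e))
  rw [Finset.card_union_of_disjoint, Finset.card_union_of_disjoint,
    Finset.card_union_of_disjoint] at h1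
  · omega
  all_goals
    rw [Finset.disjoint_left]
    intro x hx hx'
    simp only [Finset.mem_union, Finset.mem_filter, Cl, Full] at hx hx'
    tauto

open Classical in
lemma c5_clique (h4 : C4F G) (h5 : P5F G) {k : ℕ}
    (hcl : ∀ T : Finset V, G.IsClique T → T.card ≤ k)
    (h : IsC5 G a b c d e) (S : Finset V) :
    (S.filter (Cl G e b c d)).card +
      (S.filter (Cl G a c d e)).card + (S.filter (Full G a b c d e)).card ≤ k := by
  have hT := hcl (S.filter (Cl G e b c d) ∪
    S.filter (Cl G a c d e) ∪ S.filter (Full G a b c d e)) (by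
      intro u hu v hv hne
      simp only [Finset.coe_union, Finset.coe_filter, Set.mem_union, Set.mem_ofPred_eq] at hu hv
      obtain (⟨_, hu⟩ | ⟨_, hu⟩) | ⟨_, hu⟩ := hu <;> obtain (⟨_, hv⟩ | ⟨_, hv⟩) | ⟨_, hv⟩ := hv
      · exact cl_clique h4 h hu hv hne
      · exact cl_next h5 h hu hv
      · exact (full_cl h4 h hv hu).symm
      · exact (cl_next h5 h hv hu).symm
      · exact cl_clique h4 h.rot hu hv hne
      · exact (full_cl h4 h.rot hv.rot hu).symm
      · exact full_cl h4 h hu hv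
      · exact full_cl h4 h.rot hu.rot hv
      · exact full_clique h4 h hu hv hne)
  rw [Finset.card_union_of_disjoint, Finset.card_union_of_disjoint] at hT
  · exact hT
  all_goals
    rw [Finset.disjoint_left]
    intro x hx hx'
    simp only [Finset.mem_union, Finset.mem_filter, Cl, Full] at hx hx'
    tauto

open Classical in
lemma c5_color (h4 : C4F G) (h5 : P5F G) {k : ℕ} (hk : 8 ≤ k)
    (hdeg : ∀ v, ∀ T : Finset V, (∀ u ∈ T, G.Adj v u) → T.card ≤ k + 1)
    (hcl : ∀ T : Finset V, G.IsClique T → T.card ≤ k)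
    (h : IsC5 G a b c d e) (S : Finset V)
    (ha : a ∈ S) (hb : b ∈ S) (hc : c ∈ S) (hd : d ∈ S) (he : e ∈ S)
    (hZ : ∀ x ∈ S, ¬ Non G a b c d e x) : PC G k S := by
  have r1 := h.rot
  have r2 := r1.rot
  have r3 := r2.rot
  have r4 := r3.rot
  have fr1 : S.filter (Full G b c d e a) = S.filter (Full G a b c d e) := by
    ext x; simp only [Finset.mem_filter, Full]; tauto
  have fr2 : S.filter (Full G c d e a b) = S.filter (Full G a b c d e) := by
    ext x; simp only [Finset.mem_filter, Full]; tauto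
  have fr3 : S.filter (Full G d e a b c) = S.filter (Full G a b c d e) := by
    ext x; simp only [Finset.mem_filter, Full]; tauto
  have fr4 : S.filter (Full G e a b c d) = S.filter (Full G a b c d e) := by
    ext x; simp only [Finset.mem_filter, Full]; tauto
  have D0 := c5_deg h4 hdeg h S
  have D1 := c5_deg h4 hdeg r1 S
  have D2 := c5_deg h4 hdeg r2 S
  have D3 := c5_deg h4 hdeg r3 S
  have D4 := c5_deg h4 hdeg r4 S
  have K0 := c5_clique h4 h5 hcl h S
  have K1 := c5_clique h4 h5 hcl r1 S
  have K2 := c5_clique h4 h5 hcl r2 S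
  have K3 := c5_clique h4 h5 hcl r3 S
  have K4 := c5_clique h4 h5 hcl r4 S
  rw [fr1] at D1 K1
  rw [fr2] at D2 K2
  rw [fr3] at D3 K3
  rw [fr4] at D4 K4
  have P0 : 0 < (S.filter (Cl G e b c d)).card :=
    Finset.card_pos.2 ⟨a, Finset.mem_filter.2 ⟨ha, h.mem⟩⟩
  have P1 : 0 < (S.filter (Cl G a c d e)).card :=
    Finset.card_pos.2 ⟨b, Finset.mem_filter.2 ⟨hb, r1.mem⟩⟩
  have P2 : 0 < (S.filter (Cl G b d e a)).card :=
    Finset.card_pos.2 ⟨c, Finset.mem_filter.2 ⟨hc, r2.mem⟩⟩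
  have P3 : 0 < (S.filter (Cl G c e a b)).card :=
    Finset.card_pos.2 ⟨d, Finset.mem_filter.2 ⟨hd, r3.mem⟩⟩
  have P4 : 0 < (S.filter (Cl G d a b c)).card :=
    Finset.card_pos.2 ⟨e, Finset.mem_filter.2 ⟨he, r4.mem⟩⟩
  have hBdeg : 0 < (S.filter (Full G a b c d e)).card →
      (S.filter (Cl G e b c d)).card + (S.filter (Cl G a c d e)).card +
      (S.filter (Cl G b d e a)).card + (S.filter (Cl G c e a b)).card +
      (S.filter (Cl G d a b c)).card + (S.filter (Full G a b c d e)).card ≤ k + 2 := by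
    intro hpos
    obtain ⟨x, hx⟩ := Finset.card_pos.1 hpos
    have hx := (Finset.mem_filter.1 hx).2
    have hT := hdeg x ((S.filter (Cl G e b c d) ∪ S.filter (Cl G a c d e) ∪
      S.filter (Cl G b d e a) ∪ S.filter (Cl G c e a b) ∪ S.filter (Cl G d a b c) ∪
      S.filter (Full G a b c d e)).erase x) (by
        intro u hu
        simp only [Finset.mem_erase, Finset.mem_union, Finset.mem_filter] at hu
        obtain ⟨hne, ((((hu | hu) | hu) | hu) | hu) | hu⟩ := hu
        · exact full_cl h4 h hx hu.2
        · exact full_cl h4 r1 hx.rot hu.2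
        · exact full_cl h4 r2 hx.rot.rot hu.2
        · exact full_cl h4 r3 hx.rot.rot.rot hu.2
        · exact full_cl h4 r4 hx.rot.rot.rot.rot hu.2
        · exact full_clique h4 h hx hu.2 hne.symm)
    have h1 := Finset.pred_card_le_card_erase (a := x) (s := S.filter (Cl G e b c d) ∪
      S.filter (Cl G a c d e) ∪
      S.filter (Cl G b d e a) ∪ S.filter (Cl G c e a b) ∪ S.filter (Cl G d a b c) ∪
      S.filter (Full G a b c d e))
    rw [Finset.card_union_of_disjoint, Finset.card_union_of_disjoint,
      Finset.card_union_of_disjoint, Finset.card_union_of_disjoint,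
      Finset.card_union_of_disjoint] at h1
    · omega
    all_goals
      rw [Finset.disjoint_left]
      intro x hx hx'
      simp only [Finset.mem_union, Finset.mem_filter, Cl, Full] at hx hx'
      tauto
  obtain ⟨C0, C1, C2, C3, C4, B, c0, c1, c2, c3, c4, cB, d01, d12, d23, d34, d40,
    d0, d1, d2, d3, d4⟩ := pick_colors k _ _ _ _ _ _ K0 K1 K2 K3 K4 (by omega)
  refine color_classes (n := 6) S (by omega)
    ![S.filter (Cl G e b c d), S.filter (Cl G a c d e), S.filter (Cl G b d e a),
      S.filter (Cl G c e a b), S.filter (Cl G d a b c), S.filter (Full G a b c d e)]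
    ![C0, C1, C2, C3, C4, B] ?_ ?_ ?_
  · intro x hx
    rcases classify h4 h5 h x with t | t | t | t | t | t | t
    · exact ⟨0, Finset.mem_filter.2 ⟨hx, t⟩⟩
    · exact ⟨1, Finset.mem_filter.2 ⟨hx, t⟩⟩
    · exact ⟨2, Finset.mem_filter.2 ⟨hx, t⟩⟩
    · exact ⟨3, Finset.mem_filter.2 ⟨hx, t⟩⟩
    · exact ⟨4, Finset.mem_filter.2 ⟨hx, t⟩⟩
    · exact ⟨5, Finset.mem_filter.2 ⟨hx, t⟩⟩
    · exact absurd t (hZ x hx)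
  · intro i
    fin_cases i
    · exact c0.ge
    · exact c1.ge
    · exact c2.ge
    · exact c3.ge
    · exact c4.ge
    · exact cB.ge
  · have far : ∀ {a b c d e : V}, IsC5 G a b c d e → ∀ u ∈ S.filter (Cl G e b c d),
        ∀ v ∈ S.filter (Cl G b d e a), ¬ G.Adj u v := fun h u hu v hv =>
      cl_far h4 h (Finset.mem_filter.1 hu).2 (Finset.mem_filter.1 hv).2
    have sym : ∀ {X Y : Finset V}, (∀ u ∈ X, ∀ v ∈ Y, ¬ G.Adj u v) →
        ∀ u ∈ Y, ∀ v ∈ X, ¬ G.Adj u v := fun h u hu v hv t => h v hv u hu t.symm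
    have f0 := far h
    have f1 := far r1
    have f2 := far r2
    have f3 := far r3
    have f4 := far r4
    have s0 := sym f0
    have s1 := sym f1
    have s2 := sym f2
    have s3 := sym f3
    have s4 := sym f4
    intro i j hij
    fin_cases i <;> fin_cases j <;>
    first
    | exact absurd rfl hij
    | exact Or.inl (by assumption)
    | exact Or.inl (Disjoint.symm (by assumption))
    | exact Or.inr (by assumption)

open Classical in
lemma main_step (h4 : C4F G) (h5 : P5F G) {k : ℕ} (hk : 8 ≤ k)
    (hdeg : ∀ v, ∀ T : Finset V, (∀ u ∈ T, G.Adj v u) → T.card ≤ k + 1)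
    (hcl : ∀ T : Finset V, G.IsClique T → T.card ≤ k) (S : Finset V) : PC G k S := by
  induction S using Finset.strongInduction with
  | H S ih =>
  -- a 5-cycle suffices
  have hC5 : ∀ a b c d e, IsC5 G a b c d e → a ∈ S → b ∈ S → c ∈ S → d ∈ S → e ∈ S →
      PC G k S := by
    intro a b c d e h ha hb hc hd he
    by_cases hZ : ∀ x ∈ S, ¬ Non G a b c d e x
    · exact c5_color h4 h5 hk hdeg hcl h S ha hb hc hd he hZ
    push Not at hZ
    obtain ⟨z, hzS, hz⟩ := hZ
    have hcov : S = S.filter (fun x => Non G a b c d e x ∨ Full G a b c d e x) ∪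
        S.filter (fun x => ¬ Non G a b c d e x) := by
      ext x; simp only [Finset.mem_union, Finset.mem_filter]; tauto
    rw [hcov]
    apply glue
    · apply ih
      rw [Finset.filter_ssubset]
      refine ⟨a, ha, ?_⟩
      rintro (t | t)
      · exact t.2.1 h.ab
      · exact t.1.ne rfl
    · apply ih
      rw [Finset.filter_ssubset]
      exact ⟨z, hzS, fun t => t hz⟩
    · intro u hu hu' v hv hv' hne
      simp only [Finset.mem_filter] at hu hu' hv hv'
      exact full_clique h4 h (hu.2.resolve_left hu'.2) (hv.2.resolve_left hv'.2) hne
    · intro u hu hu' v hv hv'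
      simp only [Finset.mem_filter, not_and, not_not] at hu hu' hv hv'
      have hu2 := hu' hu.1
      have hv2 : ¬ Full G a b c d e v := fun t => hv' hv.1 (Or.inr t)
      rcases classify h4 h5 h v with t | t | t | t | t | t | t
      · exact non_cl h5 h hu2 t
      · exact non_cl h5 h.rot hu2.rot t
      · exact non_cl h5 h.rot.rot hu2.rot.rot t
      · exact non_cl h5 h.rot.rot.rot hu2.rot.rot.rot t
      · exact non_cl h5 h.rot.rot.rot.rot hu2.rot.rot.rot.rot t
      · exact absurd t hv2
      · exact absurd t hv.2
  by_cases hclique : G.IsClique (S : Set V)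
  · refine color_classes (n := 1) S (by omega) (fun _ => S) (fun _ => Finset.univ) ?_ ?_ ?_
    · exact fun x hx => ⟨0, hx⟩
    · intro i; simpa using hcl S hclique
    · intro i j hij; exact absurd (Subsingleton.elim i j) hij
  have : ∃ v ∈ S, ∃ w ∈ S, v ≠ w ∧ ¬ G.Adj v w := by
    by_contra hcon
    push Not at hcon
    exact hclique fun v hv w hw hne => hcon v hv w hw hne
  obtain ⟨v, hv, w, hw, hvw, hnadj⟩ := this
  let ok : V → Prop := fun x => x ∈ S ∧ x ≠ v ∧ ¬ G.Adj v x
  let H : V → Prop := fun x => Relation.ReflTransGen (fun x y => G.Adj x y ∧ ok y) w x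
  have hHok : ∀ x, H x → ok x := by
    intro x hx
    induction hx with
    | refl => exact ⟨hw, hvw.symm, hnadj⟩
    | tail _ h2 _ => exact h2.2
  have hHw : H w := Relation.ReflTransGen.refl
  have hstep : ∀ x y, H x → G.Adj x y → ok y → H y := fun x y hx hxy hy =>
    Relation.ReflTransGen.tail hx ⟨hxy, hy⟩
  let T : V → Prop := fun x => ¬ H x ∧ ∃ y, H y ∧ G.Adj x y
  have hTv : ∀ x ∈ S, T x → G.Adj v x := by
    rintro x hxS ⟨hx, y, hy, hxy⟩
    by_contra hn
    refine hx (hstep y x hy hxy.symm ⟨hxS, ?_, hn⟩)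
    rintro rfl
    exact (hHok y hy).2.2 hxy
  by_cases hTc : ∀ s ∈ S, T s → ∀ s' ∈ S, T s' → s ≠ s' → G.Adj s s'
  · have hcov : S = S.filter (fun x => H x ∨ T x) ∪ S.filter (fun x => ¬ H x) := by
      ext x; simp only [Finset.mem_union, Finset.mem_filter]; tauto
    rw [hcov]
    apply glue
    · apply ih
      rw [Finset.filter_ssubset]
      refine ⟨v, hv, ?_⟩
      rintro (t | t)
      · exact (hHok v t).2.1 rfl
      · exact (hTv v hv t).ne rfl
    · apply ih
      rw [Finset.filter_ssubset]
      exact ⟨w, hw, fun t => t hHw⟩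
    · intro s hs hs' t ht ht' hne
      simp only [Finset.mem_filter] at hs hs' ht ht'
      exact hTc s hs.1 (hs.2.resolve_left hs'.2) t ht.1 (ht.2.resolve_left ht'.2) hne
    · intro s hs hs' t ht ht' hst
      simp only [Finset.mem_filter, not_and, not_not] at hs hs' ht ht'
      exact ht' ht.1 (Or.inr ⟨ht.2, s, hs' hs.1, hst.symm⟩)
  push Not at hTc
  obtain ⟨s, hsS, hsT, s', hsS', hsT', hne, hss⟩ := hTc
  have hvs := hTv s hsS hsT
  have hvs' := hTv s' hsS' hsT'
  have hcommon : ∀ x, H x → G.Adj s x → ¬ G.Adj s' x := by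
    intro x hx h1 h2
    have hx' := hHok x hx
    exact hx'.2.2 (h4 s v s' x hvs.symm hvs' h2 h1.symm hne hx'.2.1.symm hss)
  obtain ⟨x0, hx0, hsx0⟩ := hsT.2
  obtain ⟨y0, hy0, hsy0⟩ := hsT'.2
  have hedge : ∃ x y, H x ∧ H y ∧ G.Adj x y ∧ G.Adj s x ∧ ¬ G.Adj s y := by
    by_contra hcon
    push Not at hcon
    have hall : ∀ x, H x → (G.Adj s w ↔ G.Adj s x) := by
      intro x hx
      induction hx with
      | refl => exact Iff.rfl
      | @tail p q h1 h2 ihp =>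
        have hq : H q := hstep p q h1 h2.1 h2.2
        exact ihp.trans ⟨fun t => hcon p q h1 hq h2.1 t, fun t => hcon q p hq h1 h2.1.symm t⟩
    exact hcommon y0 hy0 ((hall y0 hy0).1 ((hall x0 hx0).2 hsx0)) hsy0
  obtain ⟨x, y, hx, hy, hxy, hsx, hsy⟩ := hedge
  have okx := hHok x hx
  have oky := hHok y hy
  have hs'y : G.Adj s' y := by
    by_contra hn
    exact h5 s' v s x y hvs'.symm hvs hsx hxy (fun t => hss t.symm) (hcommon x hx hsx) hn
      okx.2.2 oky.2.2 hsy
  exact hC5 v s x y s' ⟨hvs, hsx, hxy, hs'y.symm, hvs'.symm, okx.2.2, hsy,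
    fun t => hcommon x hx hsx t.symm, fun t => oky.2.2 t.symm, fun t => hss t.symm⟩
    hv hsS okx.1 oky.1 hsS'

lemma c4f_of (h : ¬ Nonempty (cycleGraph 4 ↪g G)) : C4F G := by
  intro a b c d ab bc cd da ac bd nac
  by_contra nbd
  have ha : ∀ x : V, ¬ G.Adj x x := fun x t => t.ne rfl
  refine h ⟨⟨⟨![a, b, c, d], ?_⟩, ?_⟩⟩
  · intro i j hij
    fin_cases i <;> fin_cases j <;>
      simp_all [ab.ne, bc.ne, cd.ne, da.ne, ab.ne', bc.ne', cd.ne', da.ne', ac.symm, bd.symm]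
  · intro i j
    have : (cycleGraph 4).Adj i j ↔ (i - j = 1 ∨ j - i = 1) := by
      revert i j; decide
    rw [this]
    change G.Adj (![a, b, c, d] i) (![a, b, c, d] j) ↔ _
    have nca : ¬ G.Adj c a := fun t => nac t.symm
    have ndb : ¬ G.Adj d b := fun t => nbd t.symm
    fin_cases i <;> fin_cases j <;>
      simp [ab, bc, cd, da, ab.symm, bc.symm, cd.symm, da.symm, nac, nbd, nca, ndb] <;> decide

lemma p5f_of (h : ¬ Nonempty (pathGraph 5 ↪g G)) : P5F G := by
  intro a b c d e ab bc cd de ac ad ae bd be ce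
  have n1 : a ≠ c := by rintro rfl; exact ad cd
  have n2 : a ≠ d := by rintro rfl; exact ac cd.symm
  have n3 : a ≠ e := by rintro rfl; exact ad de.symm
  have n4 : b ≠ d := by rintro rfl; exact ad ab
  have n5 : b ≠ e := by rintro rfl; exact ae ab
  have n6 : c ≠ e := by rintro rfl; exact be bc
  refine h ⟨⟨⟨![a, b, c, d, e], ?_⟩, ?_⟩⟩
  · intro i j hij
    fin_cases i <;> fin_cases j <;>
      simp_all [ab.ne, bc.ne, cd.ne, de.ne, ab.ne', bc.ne', cd.ne', de.ne', n1.symm, n2.symm,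
        n3.symm, n4.symm, n5.symm, n6.symm]
  · intro i j
    rw [pathGraph_adj]
    change G.Adj (![a, b, c, d, e] i) (![a, b, c, d, e] j) ↔ _
    fin_cases i <;> fin_cases j <;>
      simp [ab, bc, cd, de, ab.symm, bc.symm, cd.symm, de.symm, ac, ad, ae, bd, be, ce,
        G.adj_comm c a, G.adj_comm d a, G.adj_comm e a, G.adj_comm d b, G.adj_comm e b,
        G.adj_comm e c]

end

end BK

theorem borodin_kostochka_C4_P5_free
    {V : Type*} [Fintype V]
    (G : SimpleGraph V) [DecidableRel G.Adj]
    (hΔ : 9 ≤ G.maxDegree)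
    (hC4free : ¬ Nonempty (cycleGraph 4 ↪g G))
    (hP5free : ¬ Nonempty (pathGraph 5 ↪g G)) :
    G.chromaticNumber ≤ (↑(max (G.maxDegree - 1) G.cliqueNum) : ℕ∞) := by
  have h1 : G.maxDegree - 1 ≤ max (G.maxDegree - 1) G.cliqueNum := le_max_left _ _
  have h2 : G.cliqueNum ≤ max (G.maxDegree - 1) G.cliqueNum := le_max_right _ _
  generalize max (G.maxDegree - 1) G.cliqueNum = k at h1 h2 ⊢
  obtain ⟨c, hc⟩ := BK.main_step (BK.c4f_of hC4free) (BK.p5f_of hP5free) (k := k) (by omega)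
    (fun v T hT => by
      have h3 : T ⊆ G.neighborFinset v := fun u hu => by simpa using hT u hu
      have h4 := Finset.card_le_card h3
      rw [G.card_neighborFinset_eq_degree] at h4
      have h5 := G.degree_le_maxDegree v
      omega)
    (fun T hT => by
      have := hT.card_le_cliqueNum
      omega) Finset.univ
  apply SimpleGraph.Colorable.chromaticNumber_le
  exact ⟨SimpleGraph.Coloring.mk c fun {u v} huv =>
    hc u (Finset.mem_univ _) v (Finset.mem_univ _) huv⟩
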